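/- arXiv:2005.14197 — 3 statements merged into one kernel-verified Lean document; each statement's English description precedes it below -/
import Mathlib

section
/- For every integer l ≥ 1, the polynomial q_l(z) = z·p_l′(z) − (z + l)·p_l(z) has degree l + 1 and exactly l + 1 distinct complex roots; equivalently, q_l is squarefree, i.e. every complex root z of q_l satisfies q_l′(z) ≠ 0. -/
open Polynomial

/-- The polynomial `p_l(z) = ∑_{k=0}^{l} ((l+k)! / (2^k k! (l−k)!)) z^{l−k}`. -/
noncomputable def pPoly (l : ℕ) : Polynomial ℂ :=
  ∑ k ∈ Finset.range (l + 1),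
    C (((l + k).factorial : ℂ) / (2 ^ k * (k.factorial : ℂ) * ((l - k).factorial : ℂ))) *
      X ^ (l - k)

/-- The polynomial `q_l(z) = z p_l'(z) − (z + l) p_l(z)`. -/
noncomputable def qPoly (l : ℕ) : Polynomial ℂ :=
  X * derivative (pPoly l) - (X + C (l : ℂ)) * pPoly l

theorem pPoly_coeff_add (n k : ℕ) :
    (pPoly (n + k)).coeff n =
      ((n + k + k).factorial : ℂ) / (2 ^ k * (k.factorial : ℂ) * (n.factorial : ℂ)) := by
  simp only [pPoly, finsetSum_coeff, coeff_C_mul, coeff_X_pow]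
  rw [Finset.sum_eq_single k]
  · simp
  · intro b hb hbk
    rw [if_neg, mul_zero]
    have := Finset.mem_range.mp hb
    omega
  · intro h
    exact absurd (Finset.mem_range.mpr (by omega)) h

theorem pPoly_natDegree_le (l : ℕ) : (pPoly l).natDegree ≤ l :=
  natDegree_sum_le_of_forall_le _ _ fun k _ =>
    (natDegree_C_mul_X_pow_le _ _).trans (Nat.sub_le l k)

theorem pPoly_coeff_of_lt {l n : ℕ} (h : l < n) : (pPoly l).coeff n = 0 :=
  coeff_eq_zero_of_natDegree_lt ((pPoly_natDegree_le l).trans_lt h)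

theorem pPoly_coeff_self (l : ℕ) : (pPoly l).coeff l = 1 := by
  have h := pPoly_coeff_add l 0
  have h0 : (l.factorial : ℂ) ≠ 0 := Nat.cast_ne_zero.mpr l.factorial_ne_zero
  simpa [h0] using h

theorem pPoly_eval_zero_ne_zero (l : ℕ) : (pPoly l).eval 0 ≠ 0 := by
  rw [← coeff_zero_eq_eval_zero]
  have h := pPoly_coeff_add 0 l
  rw [Nat.zero_add] at h
  rw [h]
  simp [Nat.factorial_ne_zero]

theorem pPoly_coeff_succ (l n : ℕ) :
    ((n : ℂ) + 1) * (n - 2 * l) * (pPoly l).coeff (n + 1) = 2 * (n - l) * (pPoly l).coeff n := by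
  rcases lt_trichotomy n l with h | rfl | h
  · obtain ⟨j, rfl⟩ := Nat.exists_eq_add_of_lt h
    have h1 := pPoly_coeff_add (n + 1) j
    have h2 := pPoly_coeff_add n (j + 1)
    rw [show n + 1 + j = n + j + 1 by ring] at h1
    rw [show n + (j + 1) = n + j + 1 by ring] at h2
    rw [h1, h2, show n + j + 1 + (j + 1) = (n + j + 1 + j) + 1 by ring,
      Nat.factorial_succ (n + j + 1 + j), Nat.factorial_succ j, Nat.factorial_succ n]
    have hn : (n.factorial : ℂ) ≠ 0 := Nat.cast_ne_zero.mpr n.factorial_ne_zero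
    have hj : (j.factorial : ℂ) ≠ 0 := Nat.cast_ne_zero.mpr j.factorial_ne_zero
    have hn1 : (n : ℂ) + 1 ≠ 0 := Nat.cast_add_one_ne_zero n
    have hj1 : (j : ℂ) + 1 ≠ 0 := Nat.cast_add_one_ne_zero j
    push_cast
    field_simp
    ring
  · simp [pPoly_coeff_of_lt]
  · simp [pPoly_coeff_of_lt h, pPoly_coeff_of_lt (h.trans n.lt_succ_self)]

/-- The differential equation `z p'' - 2 (z + l) p' + 2 l p = 0`. -/
theorem pPoly_ode (l : ℕ) :
    X * derivative (derivative (pPoly l)) =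
      2 * (X + C (l : ℂ)) * derivative (pPoly l) - 2 * C (l : ℂ) * pPoly l := by
  have h2 : (2 : ℂ[X]) = C 2 := rfl
  ext n
  have h := pPoly_coeff_succ l n
  rw [h2, mul_assoc, mul_assoc, add_mul]
  rcases n with _ | n
  · simp only [coeff_sub, coeff_add, coeff_C_mul, coeff_X_mul_zero, coeff_derivative] at *
    push_cast at *
    linear_combination h
  · simp only [coeff_sub, coeff_add, coeff_C_mul, coeff_X_mul, coeff_derivative] at *
    push_cast at *
    linear_combination h

theorem eq_C_mul_X_pow_of_X_mul_derivative {w : ℂ[X]} {m : ℕ}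
    (h : X * derivative w = C (m : ℂ) * w) : w = C (w.coeff m) * X ^ m := by
  ext n
  rw [coeff_C_mul_X_pow]
  split_ifs with hn
  · rw [hn]
  · have hc := congrArg (fun f => coeff f n) h
    have hnm : (n : ℂ) - m ≠ 0 := sub_ne_zero.mpr (Nat.cast_injective.ne hn)
    refine (mul_eq_zero.mp ?_).resolve_left hnm
    rcases n with _ | n
    · simp only [coeff_C_mul, coeff_X_mul_zero] at hc
      push_cast
      linear_combination hc
    · simp only [coeff_C_mul, coeff_X_mul, coeff_derivative] at hc
      push_cast
      linear_combination hc

theorem coeff_comp_neg_X (f : ℂ[X]) (n : ℕ) :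
    (f.comp (-X)).coeff n = f.coeff n * (-1) ^ n := by
  rw [show (-X : ℂ[X]) = C (-1) * X by simp, comp_C_mul_X_coeff]

/-- The Wronskian of `e^{-z} p(z)` and `e^z p(-z)`, as a polynomial. -/
theorem pPoly_wronskian (l : ℕ) :
    2 * pPoly l * (pPoly l).comp (-X) - pPoly l * (derivative (pPoly l)).comp (-X)
      - derivative (pPoly l) * (pPoly l).comp (-X) = C (2 * (-1) ^ l) * X ^ (2 * l) := by
  set p := pPoly l with hp
  set w := 2 * p * p.comp (-X) - p * (derivative p).comp (-X) - derivative p * p.comp (-X) with hw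
  have hode : X * derivative (derivative p) =
      2 * (X + C (l : ℂ)) * derivative p - 2 * C (l : ℂ) * p := pPoly_ode l
  have hode' := congrArg (fun f => f.comp (-X)) hode
  have h2 : (2 : ℂ[X]) = C 2 := rfl
  simp only [h2, mul_comp, sub_comp, add_comp, X_comp, C_comp] at hode'
  rw [← h2] at hode'
  have hX : X * derivative w = C ((2 * l : ℕ) : ℂ) * w := by
    have hC : C ((2 * l : ℕ) : ℂ) = 2 * C (l : ℂ) := by push_cast; rw [C_mul]; rfl
    rw [hC, hw]
    simp only [derivative_sub, derivative_mul, derivative_ofNat, derivative_comp, derivative_neg,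
      derivative_X]
    linear_combination (-p.comp (-X)) * hode - p * hode'
  have hdeg : p.natDegree ≤ l := pPoly_natDegree_le l
  have hdeg' : (p.comp (-X)).natDegree ≤ l := by
    rwa [natDegree_comp, natDegree_neg, natDegree_X, mul_one]
  have hd : (derivative p).coeff l = 0 := by
    rw [coeff_derivative, hp, pPoly_coeff_of_lt l.lt_succ_self, zero_mul]
  have hdd : (derivative p).natDegree ≤ l := (natDegree_derivative_le p).trans (by omega)
  have hdd' : ((derivative p).comp (-X)).natDegree ≤ l := by
    rwa [natDegree_comp, natDegree_neg, natDegree_X, mul_one]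
  have hcoeff : w.coeff (2 * l) = 2 * (-1) ^ l := by
    rw [hw, h2, mul_assoc, coeff_sub, coeff_sub, coeff_C_mul, two_mul l,
      coeff_mul_add_eq_of_natDegree_le hdeg hdeg', coeff_mul_add_eq_of_natDegree_le hdeg hdd',
      coeff_mul_add_eq_of_natDegree_le hdd hdeg', coeff_comp_neg_X, coeff_comp_neg_X, hd, hp,
      pPoly_coeff_self]
    simp
  rw [← hcoeff]
  exact eq_C_mul_X_pow_of_X_mul_derivative hX

theorem pPoly_wronskian_eval_ne_zero (l : ℕ) {z : ℂ} (hz : z ≠ 0) :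
    2 * (pPoly l).eval z * (pPoly l).eval (-z) - (pPoly l).eval z * (derivative (pPoly l)).eval (-z)
      - (derivative (pPoly l)).eval z * (pPoly l).eval (-z) ≠ 0 := by
  have h := congrArg (eval z) (pPoly_wronskian l)
  simp only [eval_sub, eval_mul, eval_comp, eval_neg, eval_X, eval_C, eval_pow, eval_ofNat] at h
  rw [h]
  simp [hz]

theorem qPoly_eval (l : ℕ) (z : ℂ) :
    (qPoly l).eval z = z * (derivative (pPoly l)).eval z - (z + l) * (pPoly l).eval z := by
  simp [qPoly]

theorem derivative_qPoly_eval (l : ℕ) (z : ℂ) :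
    (derivative (qPoly l)).eval z =
      (z + l + 1) * (derivative (pPoly l)).eval z - (2 * l + 1) * (pPoly l).eval z := by
  have h := congrArg (eval z) (pPoly_ode l)
  simp only [eval_sub, eval_mul, eval_add, eval_X, eval_C, eval_ofNat] at h
  simp only [qPoly, derivative_sub, derivative_mul, derivative_add, derivative_X, derivative_C,
    eval_sub, eval_mul, eval_add, eval_X, eval_C, eval_one, eval_zero]
  linear_combination h

theorem qPoly_eval_neg_ne_zero {l : ℕ} {z : ℂ} (hz : z ≠ 0) (h : (qPoly l).eval z = 0) :
    (qPoly l).eval (-z) ≠ 0 := by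
  intro h'
  rw [qPoly_eval] at h h'
  refine mul_ne_zero hz (pPoly_wronskian_eval_ne_zero l hz) ?_
  linear_combination (-(pPoly l).eval (-z)) * h + (pPoly l).eval z * h'

theorem qPoly_map_conj (l : ℕ) : (qPoly l).map (starRingEnd ℂ) = qPoly l := by
  have hp : (pPoly l).map (starRingEnd ℂ) = pPoly l := by
    simp [pPoly, Polynomial.map_sum, map_ofNat]
  simp [qPoly, ← derivative_map, hp]

theorem qPoly_eval_conj {l : ℕ} {z : ℂ} (h : (qPoly l).eval z = 0) :
    (qPoly l).eval (starRingEnd ℂ z) = 0 := by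
  rw [← qPoly_map_conj, eval_map_apply, h, map_zero]

theorem conj_eq_neg_of_sq {z : ℂ} {r : ℝ} (hr : 0 < r) (h : z ^ 2 + r = 0) :
    starRingEnd ℂ z = -z := by
  have hre := congrArg Complex.re h
  have him := congrArg Complex.im h
  simp only [pow_two, Complex.add_re, Complex.mul_re, Complex.ofReal_re, Complex.zero_re,
    Complex.add_im, Complex.mul_im, Complex.ofReal_im, Complex.zero_im] at hre him
  have h0 : z.re = 0 := by
    rcases mul_eq_zero.mp (show z.re * z.im = 0 by linarith) with h0 | h0
    · exact h0
    · rw [h0] at hre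
      nlinarith [mul_self_nonneg z.re]
  apply Complex.ext <;> simp [h0]

theorem derivative_qPoly_eval_ne_zero {l : ℕ} (hl : 1 ≤ l) {z : ℂ} (h : (qPoly l).eval z = 0) :
    (derivative (qPoly l)).eval z ≠ 0 := by
  intro h'
  have hl0 : (l : ℂ) ≠ 0 := Nat.cast_ne_zero.mpr (by omega)
  have hz : z ≠ 0 := by
    rintro rfl
    rw [qPoly_eval] at h
    exact mul_ne_zero hl0 (pPoly_eval_zero_ne_zero l) (by linear_combination -h)
  have hq := h
  rw [qPoly_eval] at h
  rw [derivative_qPoly_eval] at h'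
  have hdet : (z ^ 2 + ((l * (l + 1) : ℝ) : ℂ)) * (pPoly l).eval z = 0 := by
    push_cast
    linear_combination z * h' - (z + l + 1) * h
  rcases mul_eq_zero.mp hdet with hsq | hp
  · have hpos : (0 : ℝ) < l * (l + 1) := by
      have : (0 : ℝ) < l := Nat.cast_pos.mpr (by omega)
      positivity
    have hconj := qPoly_eval_conj hq
    rw [conj_eq_neg_of_sq hpos hsq] at hconj
    exact qPoly_eval_neg_ne_zero hz hq hconj
  · have hp' : (derivative (pPoly l)).eval z = 0 := by
      rw [hp, mul_zero, sub_zero] at h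
      exact (mul_eq_zero.mp h).resolve_left hz
    apply pPoly_wronskian_eval_ne_zero l hz
    rw [hp, hp']
    ring

theorem qPoly_natDegree (l : ℕ) : (qPoly l).natDegree = l + 1 := by
  have hp := pPoly_natDegree_le l
  apply natDegree_eq_of_le_of_coeff_ne_zero
  · refine (natDegree_sub_le _ _).trans (max_le ?_ ?_)
    · refine natDegree_mul_le.trans ?_
      have := natDegree_derivative_le (pPoly l)
      rw [natDegree_X]
      omega
    · refine natDegree_mul_le.trans ?_
      rw [natDegree_X_add_C]
      omega
  · rw [qPoly, add_mul]
    simp [coeff_X_mul, coeff_derivative, pPoly_coeff_of_lt, pPoly_coeff_self]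

/-- For every `l ≥ 1`, `q_l` has degree `l+1`, exactly `l+1` distinct complex roots, and is
squarefree: every root `z` of `q_l` satisfies `q_l'(z) ≠ 0`. -/
theorem qPoly_degree_and_simple_roots (l : ℕ) (hl : 1 ≤ l) :
    (qPoly l).natDegree = l + 1 ∧
    (qPoly l).roots.toFinset.card = l + 1 ∧
    ∀ z : ℂ, (qPoly l).IsRoot z → (derivative (qPoly l)).eval z ≠ 0 := by
  have hdeg := qPoly_natDegree l
  have hq : qPoly l ≠ 0 := fun h => by simp [h] at hdeg
  have hsimple : ∀ z : ℂ, (qPoly l).IsRoot z → (derivative (qPoly l)).eval z ≠ 0 :=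
    fun z hz => derivative_qPoly_eval_ne_zero hl hz
  refine ⟨hdeg, ?_, hsimple⟩
  have hnodup : (qPoly l).roots.Nodup := by
    rw [Multiset.nodup_iff_count_le_one]
    intro z
    rw [count_roots]
    by_contra! hlt
    have := (one_lt_rootMultiplicity_iff_isRoot hq).mp hlt
    exact hsimple z this.1 this.2
  rw [Multiset.toFinset_card_of_nodup hnodup, ← hdeg]
  exact (IsAlgClosed.splits (qPoly l)).natDegree_eq_card_roots.symm
end

section
/- Let l ≥ 1 be an integer, let b, c > 0 be real, and let {z_j}_{j=1}^{l} be the (distinct) complex roots of p_l, each of which has negative real part. Then for every s ∈ ℂ with Re s > 0, setting z = s·b/c: ∫₀^∞ e^(−s t) · (c/b) · ∑_{j=1}^{l} z_j · e^{(c/b) z_j t} dt = 1 + z + z·k_l′(z)/k_l(z). (That is, the NRBC kernel σ_l(t) = (c/b)∑_{j=1}^l z_j e^{(c/b) z_j t} has Laplace transform 1 + z + z·k_l′(z)/k_l(z) with z = s b/c.) -/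
open Polynomial MeasureTheory

/-- The modified spherical Bessel function of the second kind,
`k_l(z) = (π/2) e^{−z} p_l(z) / z^{l+1}`. -/
noncomputable def kFun (l : ℕ) : ℂ → ℂ :=
  fun z => (Real.pi : ℂ) / 2 * Complex.exp (-z) * (pPoly l).eval z / z ^ (l + 1)

/-- `pPoly l` is `X ^ l` plus terms of lower degree. -/
theorem exists_pPoly_eq_X_pow_add (l : ℕ) :
    ∃ q : ℂ[X], q.degree < l ∧ pPoly l = X ^ l + q := by
  refine ⟨∑ k ∈ Finset.range l,
    C (((l + (k + 1)).factorial : ℂ) /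
      (2 ^ (k + 1) * ((k + 1).factorial : ℂ) * ((l - (k + 1)).factorial : ℂ))) *
      X ^ (l - (k + 1)), ?_, ?_⟩
  · refine lt_of_le_of_lt (degree_sum_le _ _) ((Finset.sup_lt_iff (WithBot.bot_lt_coe l)).2 ?_)
    intro k hk
    have hk' := Finset.mem_range.1 hk
    refine lt_of_le_of_lt (degree_C_mul_X_pow_le _ _) ?_
    exact Nat.cast_lt.2 (by omega)
  · have h : (l.factorial : ℂ) ≠ 0 := by exact_mod_cast l.factorial_ne_zero
    rw [pPoly, Finset.sum_range_succ', add_comm]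
    simp [h]

/-- A family of `l` distinct roots gives the factorization of `pPoly l`. -/
theorem pPoly_eq_prod_X_sub_C {l : ℕ} {zt : Fin l → ℂ} (hinj : Function.Injective zt)
    (hroot : ∀ j, (pPoly l).IsRoot (zt j)) : pPoly l = ∏ j, (X - C (zt j)) := by
  obtain ⟨q, hq, hp⟩ := exists_pPoly_eq_X_pow_add l
  have hpm : (pPoly l).Monic := hp ▸ monic_X_pow_add hq
  have hpd : (pPoly l).degree = l := by
    rw [hp, degree_add_eq_left_of_degree_lt] <;> simp [hq]
  have hmon : (∏ j, (X - C (zt j))).Monic := monic_prod_X_sub_C zt Finset.univ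
  have hdeg : (∏ j, (X - C (zt j))).degree = (l : WithBot ℕ) := by simp [degree_prod]
  refine eq_of_degree_le_of_eval_index_eq Finset.univ (v := zt) hinj.injOn (by simp [hpd])
    (hpd.trans hdeg.symm) (hpm.leadingCoeff.trans hmon.leadingCoeff.symm) fun i hi => ?_
  rw [(hroot i).eq_zero, eval_prod, Finset.prod_eq_zero hi]
  simp

/-- The logarithmic derivative of `kFun l` in terms of the roots of `pPoly l`. -/
theorem deriv_kFun_div_kFun {l : ℕ} {zt : Fin l → ℂ} (hp : pPoly l = ∏ j, (X - C (zt j)))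
    {z : ℂ} (hz : z ≠ 0) (hne : ∀ j, z - zt j ≠ 0) :
    deriv (kFun l) z / kFun l z = -1 + ∑ j, (z - zt j)⁻¹ - (l + 1) / z := by
  have hprod : (∏ j, (z - zt j)) ≠ 0 := Finset.prod_ne_zero_iff.2 fun j _ => hne j
  have hk : kFun l = fun w : ℂ =>
      (Real.pi : ℂ) / 2 * Complex.exp (-w) * (∏ j, (w - zt j)) / w ^ (l + 1) := by
    funext w
    simp [kFun, hp, eval_prod]
  have hpi : (Real.pi : ℂ) / 2 ≠ 0 := by simp [Real.pi_ne_zero]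
  have hexp : logDeriv (fun w : ℂ => (Real.pi : ℂ) / 2 * Complex.exp (-w)) z = -1 := by
    have h : HasDerivAt (fun w : ℂ => (Real.pi : ℂ) / 2 * Complex.exp (-w))
        ((Real.pi : ℂ) / 2 * (Complex.exp (-z) * -1)) z :=
      ((hasDerivAt_neg z).cexp).const_mul _
    rw [logDeriv_apply, h.deriv]
    field_simp [Complex.exp_ne_zero]
  have hlin : logDeriv (fun w : ℂ => ∏ j, (w - zt j)) z = ∑ j, (z - zt j)⁻¹ := by
    rw [logDeriv_prod (f := fun j w => w - zt j) (fun j _ => hne j) fun j _ => by fun_prop]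
    simp [logDeriv_apply]
  rw [← logDeriv_apply, hk,
    logDeriv_div (f := fun w : ℂ => (Real.pi : ℂ) / 2 * Complex.exp (-w) * (∏ j, (w - zt j)))
      (g := fun w : ℂ => w ^ (l + 1))
      z (mul_ne_zero (mul_ne_zero hpi (Complex.exp_ne_zero _)) hprod) (pow_ne_zero (l + 1) hz)
      (by fun_prop) (by fun_prop),
    logDeriv_mul (f := fun w : ℂ => (Real.pi : ℂ) / 2 * Complex.exp (-w))
      z (mul_ne_zero hpi (Complex.exp_ne_zero _)) hprod (by fun_prop) (by fun_prop),
    hexp, hlin, logDeriv_pow]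
  push_cast
  rfl

/-- The Laplace transform of a finite sum of decaying exponentials. -/
theorem integral_exp_neg_mul_sum_exp {ι : Type*} [Fintype ι] (κ : ℂ) (w a : ι → ℂ) (s : ℂ)
    (h : ∀ j, (a j).re < s.re) :
    ∫ t in Set.Ioi (0 : ℝ),
        Complex.exp (-s * t) * (κ * ∑ j, w j * Complex.exp (a j * t))
      = ∑ j, κ * w j / (s - a j) := by
  have hneg : ∀ j, (a j - s).re < 0 := fun j => by simpa using h j
  have hfun : ∀ t : ℝ, Complex.exp (-s * t) * (κ * ∑ j, w j * Complex.exp (a j * t))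
      = ∑ j, κ * w j * Complex.exp ((a j - s) * t) := by
    intro t
    simp only [Finset.mul_sum]
    refine Finset.sum_congr rfl fun j _ => ?_
    rw [show (a j - s) * t = -s * t + a j * t by ring, Complex.exp_add]
    ring
  simp only [hfun]
  rw [integral_finsetSum _ fun j _ => (integrableOn_exp_mul_complex_Ioi (hneg j) 0).const_mul _]
  refine Finset.sum_congr rfl fun j _ => ?_
  rw [integral_const_mul, integral_exp_mul_complex_Ioi (hneg j)]
  rw [← neg_sub s (a j), div_neg, neg_div]
  simp [div_eq_mul_inv]

/-- The NRBC kernel `σ_l(t) = (c/b) ∑_{j=1}^l z_j e^{(c/b) z_j t}`, where `{z_j}` are the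
distinct roots of `p_l` (all with negative real part), has Laplace transform
`1 + z + z k_l′(z)/k_l(z)` with `z = s b / c`, for every `s` with `Re s > 0`. -/
theorem sigma_kernel_laplace_transform (l : ℕ) (hl : 1 ≤ l) (b c : ℝ)
    (hb : 0 < b) (hc : 0 < c) (zt : Fin l → ℂ) (hinj : Function.Injective zt)
    (hroot : ∀ j, (pPoly l).IsRoot (zt j)) (hre : ∀ j, (zt j).re < 0)
    (s : ℂ) (hs : 0 < s.re) :
    ∫ t in Set.Ioi (0 : ℝ),
        Complex.exp (-s * t) *
          ((c / b : ℂ) * ∑ j, zt j * Complex.exp ((c / b : ℂ) * zt j * t))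
      = 1 + s * b / c
        + (s * b / c) * deriv (kFun l) (s * b / c) / kFun l (s * b / c) := by
  have hbC : (b : ℂ) ≠ 0 := by exact_mod_cast hb.ne'
  have hcC : (c : ℂ) ≠ 0 := by exact_mod_cast hc.ne'
  have hs0 : s ≠ 0 := by
    rintro rfl
    simp at hs
  have hare : ∀ j, ((c / b : ℂ) * zt j).re < s.re := fun j => by
    rw [← Complex.ofReal_div, Complex.re_ofReal_mul]
    exact (mul_neg_of_pos_of_neg (div_pos hc hb) (hre j)).trans hs
  have hzre : 0 < (s * b / c).re := by
    rw [Complex.div_ofReal_re, Complex.re_mul_ofReal]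
    positivity
  have hz : s * b / c ≠ 0 := div_ne_zero (mul_ne_zero hs0 hbC) hcC
  have hne : ∀ j, s * b / c - zt j ≠ 0 := fun j h => by
    have := hre j
    rw [← sub_eq_zero.1 h] at this
    exact this.not_gt hzre
  have hterm : ∀ j, (c / b : ℂ) * zt j / (s - c / b * zt j)
      = s * b / c * (s * b / c - zt j)⁻¹ - 1 := fun j => by
    have hs' : s - c / b * zt j = c / b * (s * b / c - zt j) := by field_simp
    rw [hs', mul_div_mul_left _ _ (div_ne_zero hcC hbC), eq_sub_iff_add_eq,
      div_add_one (hne j), ← div_eq_mul_inv, add_sub_cancel]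
  rw [integral_exp_neg_mul_sum_exp _ _ _ _ hare, mul_div_assoc (s * b / c),
    deriv_kFun_div_kFun (pPoly_eq_prod_X_sub_C hinj hroot) hz hne,
    Finset.sum_congr rfl fun j _ => hterm j, Finset.sum_sub_distrib, ← Finset.mul_sum]
  generalize s * b / c = z at *
  simp only [Finset.sum_const, Finset.card_univ, Fintype.card_fin, nsmul_eq_mul]
  field_simp
  ring
end

section
/- Let γ > 0 and ω_c > 0 be real numbers and let ε ∈ (0, 1). Set ω_p² = ω_c(ω_c − iγ)(1 − ε) ∈ ℂ. Then every complex root z of the quadratic equation z² − iγ·z − ω_p² = 0 has strictly positive imaginary part. -/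
/-- Every complex root of the Drude quadratic `z² − iγz − ω_p² = 0`, with
`ω_p² = ω_c(ω_c − iγ)(1 − ε)`, `γ > 0`, `ω_c > 0` and `ε ∈ (0,1)`, has strictly positive
imaginary part. -/
theorem drude_quadratic_roots_im_pos (γ ωc ε : ℝ) (hγ : 0 < γ) (hωc : 0 < ωc)
    (hε0 : 0 < ε) (hε1 : ε < 1) :
    ∀ z : ℂ,
      z ^ 2 - Complex.I * (γ : ℂ) * z
          - (ωc : ℂ) * ((ωc : ℂ) - Complex.I * (γ : ℂ)) * (1 - (ε : ℂ)) = 0 →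
      0 < z.im := by
  intro z hz
  have hre := congrArg Complex.re hz
  have him := congrArg Complex.im hz
  simp [pow_two] at hre him
  by_contra! hy
  have hs : 0 < 1 - ε := sub_pos.mpr hε1
  have hlin : z.re * (γ - 2 * z.im) = ωc * (1 - ε) * γ := by linarith
  have hden : 0 < γ - 2 * z.im := by linarith
  have hx : 0 < z.re := by
    refine pos_of_mul_pos_left ?_ hden.le
    rw [hlin]
    positivity
  have hxle : z.re ≤ ωc * (1 - ε) := by
    refine le_of_mul_le_mul_right ?_ hγ
    nlinarith [mul_nonneg hx.le (neg_nonneg.mpr hy)]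
  have hsq : z.re * z.re ≤ (ωc * (1 - ε)) * (ωc * (1 - ε)) :=
    mul_self_le_mul_self hx.le hxle
  have hgap : 0 < ωc * ωc * (1 - ε) * ε := by positivity
  nlinarith [mul_self_nonneg z.im, mul_nonneg hγ.le (neg_nonneg.mpr hy)]
end
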